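/- Let G be a Θ1-graph with branch vertices x and y joined by four internally disjoint paths P_1, P_2, P_3, P_4, and let a denote the minimum of the four path lengths. Let e = uv be an edge of G such that exactly one of x, y belongs to N_0(e). Then |n_u(e) − n_v(e)| ≥ 2(a − 1). -/

import Mathlib

attribute [local instance] Classical.propDecidable

noncomputable def nC {V : Type*} [Fintype V] (G : SimpleGraph V) (u v : V) : ℕ :=
  (Finset.univ.filter fun w => G.dist u w < G.dist v w).card

/-- Two paths are internally disjoint if every common vertex is an endpoint of both. -/
def IntDisj {V : Type*} {G : SimpleGraph V} {x y x' y' : V}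
    (P : G.Walk x y) (Q : G.Walk x' y') : Prop :=
  ∀ v : V, v ∈ P.support → v ∈ Q.support → (v = x ∨ v = y) ∧ (v = x' ∨ v = y')
/-- `G` consists of the two distinct vertices `x, y` joined by the four pairwise
internally disjoint paths `P₁, P₂, P₃, P₄`, every vertex and every edge of `G`
lying on one of these paths. -/
def Theta1Cond {V : Type*} (G : SimpleGraph V) (x y : V)
    (P₁ P₂ P₃ P₄ : G.Walk x y) : Prop :=
  x ≠ y ∧
  P₁.IsPath ∧ P₂.IsPath ∧ P₃.IsPath ∧ P₄.IsPath ∧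
  1 ≤ P₁.length ∧ 1 ≤ P₂.length ∧ 1 ≤ P₃.length ∧ 1 ≤ P₄.length ∧
  P₁ ≠ P₂ ∧ P₁ ≠ P₃ ∧ P₁ ≠ P₄ ∧ P₂ ≠ P₃ ∧ P₂ ≠ P₄ ∧ P₃ ≠ P₄ ∧
  IntDisj P₁ P₂ ∧ IntDisj P₁ P₃ ∧ IntDisj P₁ P₄ ∧
  IntDisj P₂ P₃ ∧ IntDisj P₂ P₄ ∧ IntDisj P₃ P₄ ∧
  (∀ v : V, v ∈ P₁.support ∨ v ∈ P₂.support ∨ v ∈ P₃.support ∨ v ∈ P₄.support) ∧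
  (∀ e ∈ G.edgeSet, e ∈ P₁.edges ∨ e ∈ P₂.edges ∨ e ∈ P₃.edges ∨ e ∈ P₄.edges)

/-- `G` is a Θ₁-graph. -/
def IsTheta1 {V : Type*} (G : SimpleGraph V) : Prop :=
  ∃ (x y : V) (P₁ P₂ P₃ P₄ : G.Walk x y), Theta1Cond G x y P₁ P₂ P₃ P₄

/-- `P j` enumerates, for `k ≤ l j`, the vertices of the `j`-th of a family of internally
disjoint paths from `x` to `y` which together cover all vertices and edges of `G`. -/
structure IsThetaParam {V ι : Type*} (G : SimpleGraph V) (x y : V) (l : ι → ℕ)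
    (P : ι → ℕ → V) : Prop where
  start : ∀ j, P j 0 = x
  finish : ∀ j, P j (l j) = y
  pos : ∀ j, 1 ≤ l j
  adj : ∀ j k, k < l j → G.Adj (P j k) (P j (k + 1))
  inj : ∀ j k j' k', k ≤ l j → k' ≤ l j' → P j k = P j' k' →
    (j = j' ∧ k = k') ∨ (k = 0 ∧ k' = 0) ∨ (k = l j ∧ k' = l j')
  cover : ∀ w, ∃ j k, k ≤ l j ∧ P j k = w
  cover_adj : ∀ a b, G.Adj a b → ∃ j k, k < l j ∧
    ((P j k = a ∧ P j (k + 1) = b) ∨ (P j k = b ∧ P j (k + 1) = a))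

namespace IsThetaParam

variable {V ι : Type*} {G : SimpleGraph V} {x y : V} {l : ι → ℕ} {P : ι → ℕ → V}

theorem reverse (h : IsThetaParam G x y l P) :
    IsThetaParam G y x l (fun j k => P j (l j - k)) where
  start j := h.finish j
  finish j := by simpa using h.start j
  pos := h.pos
  adj j k hk := by
    have := h.adj j (l j - (k + 1)) (by omega)
    rw [show l j - (k + 1) + 1 = l j - k by omega] at this
    exact this.symm
  inj j k j' k' hk hk' e := by
    rcases h.inj _ _ _ _ (Nat.sub_le _ _) (Nat.sub_le _ _) e with ⟨rfl, h1⟩ | h1 | h1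
    · exact Or.inl ⟨rfl, by omega⟩
    · omega
    · omega
  cover w := by
    obtain ⟨j, k, hk, rfl⟩ := h.cover w
    exact ⟨j, l j - k, by omega, by rw [show l j - (l j - k) = k by omega]⟩
  cover_adj a b hab := by
    obtain ⟨j, k, hk, hjk⟩ := h.cover_adj a b hab
    refine ⟨j, l j - (k + 1), by omega, ?_⟩
    rw [show l j - (l j - (k + 1)) = k + 1 by omega,
      show l j - (l j - (k + 1) + 1) = k by omega]
    tauto

theorem connected (h : IsThetaParam G x y l P) : G.Connected := by
  have key : ∀ j k, k ≤ l j → G.Reachable x (P j k) := by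
    intro j k
    induction k with
    | zero => intro _; rw [h.start]
    | succ k ih => intro hk; exact (ih (by omega)).trans (h.adj j k (by omega)).reachable
  have key' : ∀ w, G.Reachable x w := by
    intro w
    obtain ⟨j, k, hk, rfl⟩ := h.cover w
    exact key j k hk
  have : Nonempty V := ⟨x⟩
  exact ⟨fun a b => (key' a).symm.trans (key' b)⟩

theorem dist_le_sub (h : IsThetaParam G x y l P) (j : ι) (k n : ℕ) (hkn : k ≤ n)
    (hn : n ≤ l j) : G.dist (P j k) (P j n) ≤ n - k := by
  induction n, hkn using Nat.le_induction with
  | base => simp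
  | succ n hkn ih =>
    have h1 := h.connected.dist_triangle (u := P j k) (v := P j n) (w := P j (n + 1))
    have h2 := SimpleGraph.dist_eq_one_iff_adj.2 (h.adj j n (by omega))
    have h3 := ih (by omega)
    omega

/-- A function on positions that is constant on the two ends and changes by at most one along
each edge bounds the distance from below. -/
theorem sub_le_dist (h : IsThetaParam G x y l P) (φ : ι → ℕ → ℤ) (X Y : ℤ)
    (hX : ∀ j, φ j 0 = X) (hY : ∀ j, φ j (l j) = Y)
    (hφ : ∀ j k, k < l j → φ j k - φ j (k + 1) ≤ 1 ∧ φ j (k + 1) - φ j k ≤ 1)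
    (j : ι) (k : ℕ) (hk : k ≤ l j) (j' : ι) (k' : ℕ) (hk' : k' ≤ l j') :
    φ j' k' - φ j k ≤ G.dist (P j k) (P j' k') := by
  choose J K hle hP using h.cover
  have hf : ∀ j k, k ≤ l j → φ (J (P j k)) (K (P j k)) = φ j k := by
    intro j k hk
    rcases h.inj _ _ _ _ (hle (P j k)) hk (hP (P j k)) with ⟨h1, h2⟩ | ⟨h1, h2⟩ | ⟨h1, h2⟩
    · rw [h1, h2]
    · rw [h1, h2, hX, hX]
    · rw [h1, h2, hY, hY]
  have hwalk : ∀ {a b : V} (p : G.Walk a b), φ (J b) (K b) - φ (J a) (K a) ≤ p.length := by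
    intro a b p
    induction p with
    | nil => simp
    | @cons a c b hac p ih =>
      have hstep : φ (J c) (K c) - φ (J a) (K a) ≤ 1 := by
        obtain ⟨j, k, hk, ⟨rfl, rfl⟩ | ⟨rfl, rfl⟩⟩ := h.cover_adj a c hac <;>
        · rw [hf j k hk.le, hf j (k + 1) hk]
          have := hφ j k hk
          omega
      rw [SimpleGraph.Walk.length_cons]
      push_cast
      omega
  obtain ⟨p, hp⟩ := h.connected.exists_walk_length_eq_dist (P j k) (P j' k')
  have := hwalk p
  rwa [hf j k hk, hf j' k' hk', hp] at this

theorem dist_same_and_dist_other (h : IsThetaParam G x y l P) (j₀ j₁ : ι)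
    (hm : ∀ j, j ≠ j₀ → l j₁ ≤ l j) (i : ℕ) (hi : i ≤ l j₀) :
    (∀ k ≤ l j₀, (G.dist (P j₀ i) (P j₀ k) : ℤ) =
      min (max ((k : ℤ) - i) (i - k)) (min (i + l j₁ + l j₀ - k) (k + l j₁ + l j₀ - i))) ∧
    (∀ j, j ≠ j₀ → ∀ k ≤ l j, (G.dist (P j₀ i) (P j k) : ℤ) =
      min (min (i : ℤ) (l j₀ - i + l j₁) + k) (min (l j₀ - i : ℤ) (i + l j₁) + l j - k)) := by
  classical
  let φ : ι → ℕ → ℤ := fun j k => if j = j₀ then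
      min (max ((k : ℤ) - i) (i - k)) (min (i + l j₁ + l j₀ - k) (k + l j₁ + l j₀ - i))
    else min (min (i : ℤ) (l j₀ - i + l j₁) + k) (min (l j₀ - i : ℤ) (i + l j₁) + l j - k)
  have lower := h.sub_le_dist φ (min (i : ℤ) (l j₀ - i + l j₁)) (min (l j₀ - i : ℤ) (i + l j₁))
    (by
      intro j
      by_cases e : j = j₀
      · simp only [φ, e, if_true]; omega
      · have := hm j e
        simp only [φ, e, if_false]; omega)
    (by
      intro j
      by_cases e : j = j₀
      · simp only [φ, e, if_true]; omega
      · have := hm j e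
        simp only [φ, e, if_false]; omega)
    (by
      intro j k hk
      by_cases e : j = j₀
      · simp only [φ, e, if_true]; push_cast; omega
      · simp only [φ, e, if_false]; push_cast; omega)
    j₀ i hi
  have tri : ∀ a b c : V, G.dist a c ≤ G.dist a b + G.dist b c :=
    fun a b c => h.connected.dist_triangle
  have toStart : ∀ j k, k ≤ l j → G.dist x (P j k) ≤ k := fun j k hk => by
    simpa [h.start] using h.dist_le_sub j 0 k (Nat.zero_le _) hk
  have toFinish : ∀ j k, k ≤ l j → G.dist (P j k) y ≤ l j - k := fun j k hk => by
    simpa [h.finish] using h.dist_le_sub j k (l j) hk le_rfl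
  have ends : G.dist x y ≤ l j₁ := by simpa [h.start] using toFinish j₁ 0 (Nat.zero_le _)
  have hx := toStart j₀ i hi
  have hy := toFinish j₀ i hi
  have hφi : φ j₀ i = 0 := by simp only [φ, if_true]; omega
  refine ⟨fun k hk => ?_, fun j e k hk => ?_⟩
  · have low := lower j₀ k hk
    rw [hφi] at low
    simp only [φ, if_true] at low
    have kx := toStart j₀ k hk
    have ky := toFinish j₀ k hk
    have direct : (G.dist (P j₀ i) (P j₀ k) : ℤ) ≤ max ((k : ℤ) - i) (i - k) := by
      rcases le_total i k with hik | hik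
      · have := h.dist_le_sub j₀ i k hik hk
        omega
      · have := h.dist_le_sub j₀ k i hik hi
        rw [SimpleGraph.dist_comm] at this
        omega
    have t1 := tri (P j₀ i) x (P j₀ k)
    have t2 := tri x y (P j₀ k)
    have t3 := tri (P j₀ i) y (P j₀ k)
    have t4 := tri y x (P j₀ k)
    rw [SimpleGraph.dist_comm (u := P j₀ i) (v := x)] at t1
    rw [SimpleGraph.dist_comm (u := y) (v := P j₀ k)] at t2 t3
    rw [SimpleGraph.dist_comm (u := y) (v := P j₀ k), SimpleGraph.dist_comm (u := y) (v := x)] at t4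
    omega
  · have low := lower j k hk
    rw [hφi] at low
    simp only [φ, e, if_false] at low
    have kx := toStart j k hk
    have ky := toFinish j k hk
    have t1 := tri (P j₀ i) x (P j k)
    have t2 := tri (P j₀ i) y (P j k)
    have t3 := tri (P j₀ i) y x
    have t4 := tri (P j₀ i) x y
    rw [SimpleGraph.dist_comm (u := P j₀ i) (v := x)] at t1 t3 t4
    rw [SimpleGraph.dist_comm (u := y) (v := P j k)] at t2
    rw [SimpleGraph.dist_comm (u := y) (v := x)] at t3
    omega

theorem nC_add_le [Fintype V] {l : Fin 4 → ℕ} {P : Fin 4 → ℕ → V}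
    (h : IsThetaParam G x y l P) (j₀ j₁ : Fin 4)
    (hm : ∀ j, j ≠ j₀ → l j₁ ≤ l j) (i : ℕ) (hi : i < l j₀)
    (hyeq : l j₀ = 2 * i + 1 + l j₁) :
    nC G (P j₀ (i + 1)) (P j₀ i) + 2 * (l j₁ - 1) ≤ nC G (P j₀ i) (P j₀ (i + 1)) := by
  obtain ⟨su, ou⟩ := h.dist_same_and_dist_other j₀ j₁ hm i hi.le
  obtain ⟨sv, ov⟩ := h.dist_same_and_dist_other j₀ j₁ hm (i + 1) hi
  have pos := h.pos j₁
  have upper : nC G (P j₀ (i + 1)) (P j₀ i) ≤ i + l j₁ := by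
    have hsub : (Finset.univ.filter fun w =>
        G.dist (P j₀ (i + 1)) w < G.dist (P j₀ i) w) ⊆
        (Finset.Ico (i + 1) (l j₀)).image (P j₀) := by
      intro w hw
      obtain ⟨j, k, hk, rfl⟩ := h.cover w
      simp only [Finset.mem_filter, Finset.mem_univ, true_and] at hw
      by_cases e : j = j₀
      · subst e
        have h1 := su k hk
        have h2 := sv k hk
        push_cast at h2
        exact Finset.mem_image_of_mem _ (Finset.mem_Ico.2 (by omega))
      · have h1 := ou j e k hk
        have h2 := ov j e k hk
        push_cast at h2
        omega
    have := (Finset.card_le_card hsub).trans Finset.card_image_le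
    rw [Nat.card_Ico] at this
    unfold nC
    omega
  have lower : i + 1 + 3 * (l j₁ - 1) ≤ nC G (P j₀ i) (P j₀ (i + 1)) := by
    let S : Finset (Fin 4 × ℕ) := ({j₀} : Finset (Fin 4)) ×ˢ Finset.range (i + 1) ∪
      (Finset.univ.erase j₀) ×ˢ Finset.Ico 1 (l j₁)
    have hS : S.card = i + 1 + 3 * (l j₁ - 1) := by
      rw [Finset.card_union_of_disjoint, Finset.card_product, Finset.card_product]
      · simp
      · rw [Finset.disjoint_left]
        rintro ⟨j, k⟩ h1 h2
        simp only [Finset.mem_product, Finset.mem_singleton, Finset.mem_erase] at h1 h2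
        exact h2.1.1 h1.1
    have mem : ∀ p ∈ S, (p.1 = j₀ ∧ p.2 ≤ i) ∨ (p.1 ≠ j₀ ∧ 1 ≤ p.2 ∧ p.2 < l j₁) := by
      intro p hp
      simp only [S, Finset.mem_union, Finset.mem_product, Finset.mem_singleton,
        Finset.mem_range, Finset.mem_erase, Finset.mem_univ, and_true, Finset.mem_Ico] at hp
      rcases hp with ⟨h1, h2⟩ | ⟨h1, h2⟩
      · exact Or.inl ⟨h1, by omega⟩
      · exact Or.inr ⟨h1, h2⟩
    have bound : ∀ p ∈ S, p.2 < l p.1 := by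
      rintro ⟨j, k⟩ hp
      rcases mem _ hp with ⟨rfl, h2⟩ | ⟨h1, h2⟩
      · exact lt_of_le_of_lt h2 hi
      · exact lt_of_lt_of_le h2.2 (hm _ h1)
    rw [← hS]
    apply Finset.card_le_card_of_injOn (fun p => P p.1 p.2)
    · rintro ⟨j, k⟩ hp
      have hk := bound _ hp
      simp only [Finset.coe_filter, Finset.mem_univ, true_and, Set.mem_ofPred_eq]
      rcases mem _ hp with ⟨rfl, h2⟩ | ⟨h1, h2⟩
      · have h3 := su k hk.le
        have h4 := sv k hk.le
        push_cast at h4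
        dsimp only at *
        omega
      · have h3 := ou j h1 k hk.le
        have h4 := ov j h1 k hk.le
        push_cast at h4
        have := hm j h1
        dsimp only at *
        omega
    · rintro ⟨j, k⟩ hp ⟨j', k'⟩ hp' e
      have hk := bound _ hp
      have hk' := bound _ hp'
      have h1 := mem _ hp
      have h2 := mem _ hp'
      dsimp only at *
      rcases h.inj _ _ _ _ hk.le hk'.le e with ⟨rfl, rfl⟩ | ⟨rfl, rfl⟩ | h3
      · rfl
      · rcases h1 with h1 | h1
        · rcases h2 with h2 | h2
          · rw [h1.1, h2.1]
          · omega
        · omega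
      · omega
  omega

theorem le_abs_nC_sub [Fintype V] {l : Fin 4 → ℕ} {P : Fin 4 → ℕ → V}
    (h : IsThetaParam G x y l P) (j₀ : Fin 4) (i : ℕ) (hi : i < l j₀)
    (heq : G.dist (P j₀ i) x = G.dist (P j₀ (i + 1)) x ∨
      G.dist (P j₀ i) y = G.dist (P j₀ (i + 1)) y)
    (a : ℕ) (ha : ∀ j, a ≤ l j) :
    2 * ((a : ℤ) - 1) ≤ |(nC G (P j₀ i) (P j₀ (i + 1)) : ℤ) - nC G (P j₀ (i + 1)) (P j₀ i)| := by
  obtain ⟨j₁, hm⟩ : ∃ j₁, ∀ j, j ≠ j₀ → l j₁ ≤ l j := by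
    obtain ⟨j₁, -, h2⟩ := Finset.exists_min_image (Finset.univ.erase j₀) l
      ⟨j₀ + 1, by simp⟩
    exact ⟨j₁, fun j hj => h2 j (by simp [hj])⟩
  have ha₁ := ha j₁
  have pos := h.pos j₁
  have su := (h.dist_same_and_dist_other j₀ j₁ hm i hi.le).1
  have sv := (h.dist_same_and_dist_other j₀ j₁ hm (i + 1) hi).1
  have ux := su 0 (Nat.zero_le _)
  have vx := sv 0 (Nat.zero_le _)
  have uy := su (l j₀) le_rfl
  have vy := sv (l j₀) le_rfl
  rw [h.start] at ux vx
  rw [h.finish] at uy vy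
  push_cast at ux vx uy vy
  rcases heq with hx | hy
  · have := h.reverse.nC_add_le j₀ j₁ hm (l j₀ - (i + 1)) (by omega) (by omega)
    simp only [show l j₀ - (l j₀ - (i + 1)) = i + 1 by omega,
      show l j₀ - (l j₀ - (i + 1) + 1) = i by omega] at this
    exact le_trans (by omega) (neg_le_abs _)
  · have := h.nC_add_le j₀ j₁ hm i hi (by omega)
    exact le_trans (by omega) (le_abs_self _)

end IsThetaParam

theorem exists_getVert_of_mem_edges {V : Type*} {G : SimpleGraph V} {x y a b : V}
    {p : G.Walk x y} (h : s(a, b) ∈ p.edges) : ∃ k < p.length,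
      (p.getVert k = a ∧ p.getVert (k + 1) = b) ∨ (p.getVert k = b ∧ p.getVert (k + 1) = a) := by
  rw [← SimpleGraph.Walk.adj_toSubgraph_iff_mem_edges, SimpleGraph.Walk.toSubgraph_adj_iff] at h
  obtain ⟨k, hk, hlt⟩ := h
  refine ⟨k, hlt, ?_⟩
  rw [Sym2.eq_iff] at hk
  tauto

theorem eq_endpoint_indices_of_intDisj {V : Type*} {G : SimpleGraph V} {x y : V}
    {p q : G.Walk x y} (hp : p.IsPath) (hq : q.IsPath) (h : IntDisj p q) {k k' : ℕ}
    (hk : k ≤ p.length) (hk' : k' ≤ q.length) (e : p.getVert k = q.getVert k') :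
    (k = 0 ∧ k' = 0) ∨ (k = p.length ∧ k' = q.length) := by
  rcases (h (p.getVert k) (p.getVert_mem_support k) (e ▸ q.getVert_mem_support k')).1 with hx | hy
  · exact Or.inl ⟨hp.getVert_injOn hk (Nat.zero_le _) (by simp [hx]),
      hq.getVert_injOn hk' (Nat.zero_le _) (by simp [← e, hx])⟩
  · exact Or.inr ⟨hp.getVert_injOn hk (le_refl p.length) (by simp [hy]),
      hq.getVert_injOn hk' (le_refl q.length) (by simp [← e, hy])⟩

theorem IntDisj.symm {V : Type*} {G : SimpleGraph V} {x y x' y' : V} {p : G.Walk x y}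
    {q : G.Walk x' y'} (h : IntDisj p q) : IntDisj q p :=
  fun v hq hp => (h v hp hq).symm

theorem Theta1Cond.isThetaParam {V : Type*} {G : SimpleGraph V} {x y : V}
    {P₁ P₂ P₃ P₄ : G.Walk x y} (h : Theta1Cond G x y P₁ P₂ P₃ P₄) :
    IsThetaParam G x y (fun j => (![P₁, P₂, P₃, P₄] j).length)
      (fun j => (![P₁, P₂, P₃, P₄] j).getVert) := by
  obtain ⟨-, p1, p2, p3, p4, l1, l2, l3, l4, -, -, -, -, -, -, d12, d13, d14, d23, d24, d34,
    hv, he⟩ := h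
  have path : ∀ j, (![P₁, P₂, P₃, P₄] j).IsPath := by
    simp [Fin.forall_fin_succ, p1, p2, p3, p4]
  have disj : ∀ j j', j ≠ j' → IntDisj (![P₁, P₂, P₃, P₄] j) (![P₁, P₂, P₃, P₄] j') := by
    simp [Fin.forall_fin_succ, d12, d13, d14, d23, d24, d34, d12.symm, d13.symm, d14.symm,
      d23.symm, d24.symm, d34.symm]
  refine ⟨fun j => by simp, fun j => by simp, ?_, fun j k hk => ?_, ?_, ?_, ?_⟩
  · simp [Fin.forall_fin_succ, l1, l2, l3, l4]
  · exact SimpleGraph.Walk.adj_getVert_succ _ hk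
  · intro j k j' k' hk hk' e
    by_cases hjj : j = j'
    · subst hjj
      exact Or.inl ⟨rfl, (path j).getVert_injOn hk hk' e⟩
    · exact Or.inr (eq_endpoint_indices_of_intDisj (path j) (path j') (disj j j' hjj) hk hk' e)
  · intro w
    have : ∃ j, w ∈ (![P₁, P₂, P₃, P₄] j).support := by
      simpa [Fin.exists_fin_succ] using hv w
    obtain ⟨j, hj⟩ := this
    obtain ⟨k, hk, hle⟩ := SimpleGraph.Walk.mem_support_iff_exists_getVert.1 hj
    exact ⟨j, k, hle, hk⟩
  · intro a b hab
    have : ∃ j, s(a, b) ∈ (![P₁, P₂, P₃, P₄] j).edges := by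
      simpa [Fin.exists_fin_succ] using he _ hab
    obtain ⟨j, hj⟩ := this
    exact ⟨j, exists_getVert_of_mem_edges hj⟩

/-- In a Θ₁-graph with branch vertices `x, y` and paths `P₁, P₂, P₃, P₄`, let `a` be
the minimum of the four path lengths. If `e = uv` is an edge such that exactly one of
`x, y` belongs to `N₀(e)`, then `|n_u(e) − n_v(e)| ≥ 2(a − 1)`. -/
theorem theta1_diff_of_equidistant {V : Type*} [Fintype V] {G : SimpleGraph V}
    {x y : V} {P₁ P₂ P₃ P₄ : G.Walk x y} (hΘ : Theta1Cond G x y P₁ P₂ P₃ P₄)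
    (u v : V) (he : G.Adj u v)
    (hxor : Xor' (G.dist u x = G.dist v x) (G.dist u y = G.dist v y))
    (a : ℕ) (ha : a = min (min P₁.length P₂.length) (min P₃.length P₄.length)) :
    2 * ((a : ℤ) - 1) ≤ |(nC G u v : ℤ) - (nC G v u : ℤ)| := by
  have h := hΘ.isThetaParam
  have heq := hxor.imp And.left And.left
  have ha' : ∀ j, a ≤ (![P₁, P₂, P₃, P₄] j).length := by
    intro j
    fin_cases j <;> simp [ha]
  obtain ⟨j, i, hi, ⟨rfl, rfl⟩ | ⟨rfl, rfl⟩⟩ := h.cover_adj u v he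
  · exact h.le_abs_nC_sub j i hi heq a ha'
  · rw [abs_sub_comm]
    exact h.le_abs_nC_sub j i hi (heq.imp Eq.symm Eq.symm) a ha'
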